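/- Let n = 2 and let P₁Mon = {a ∈ S₂ : a₂ ≥ 1} be the set of exponents of monomials in the prime ideal P₁ = ⟨st, st²⟩ of R_{A₂} = ℂ[s, st, st²]. For every d = (d₁,d₂) ∈ ℤ², the vanishing ideal in ℂ[θ₁,θ₂] of the set Ω(d) ∪ {a ∈ P₁Mon : a + d ∉ P₁Mon} is the principal ideal generated by E₁ · (H₂, −2d₁+d₂−1)!, where E₁ = (H₁, −d₂)! if d₂ < 0 and E₁ = 1 if d₂ ≥ 0. (This computes all graded pieces of the idealizer II(P₁).) -/

import Mathlib

open MvPolynomial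

noncomputable section

/-- The polynomial ring ℂ[θ₁, θ₂]. -/
abbrev Cθ : Type := MvPolynomial (Fin 2) ℂ

/-- The vanishing ideal of a set `V ⊆ ℤ²` inside ℂ[θ₁, θ₂]. -/
def vanishingIdeal (V : Set (ℤ × ℤ)) : Ideal Cθ where
  carrier := {f | ∀ a ∈ V, eval ![(a.1 : ℂ), (a.2 : ℂ)] f = 0}
  add_mem' := by
    intro f g hf hg a ha
    simp [map_add, hf a ha, hg a ha]
  zero_mem' := by
    intro a _
    simp
  smul_mem' := by
    intro c f hf a ha
    simp [smul_eq_mul, hf a ha]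

/-- The descending factorial `(P, m)! = ∏_{j=0}^{m} (P - j)`, equal to `1` when `m < 0`. -/
def dfact (P : Cθ) (m : ℤ) : Cθ :=
  ∏ j ∈ Finset.range (m + 1).toNat, (P - C (j : ℂ))

/-- The saturated affine semigroup `S_n = {(x, y) ∈ ℤ² : 0 ≤ y ≤ n x}` of the rational
normal curve of degree `n`. -/
def Sset (n : ℤ) : Set (ℤ × ℤ) := {a | 0 ≤ a.2 ∧ a.2 ≤ n * a.1}

/-- `Ω(d) = {a ∈ S_n : a + d ∉ S_n}`. -/
def Omega (n : ℤ) (d : ℤ × ℤ) : Set (ℤ × ℤ) := {a | a ∈ Sset n ∧ a + d ∉ Sset n}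

/-- `JMon_n = {a ∈ S_n : h₁(a) > 0 and h₂(a) > 0}`, the exponents of the monomials of the
radical interior ideal `J = ⟨st, …, stⁿ⁻¹⟩`. -/
def JMon (n : ℤ) : Set (ℤ × ℤ) := {a | a ∈ Sset n ∧ 0 < a.2 ∧ 0 < n * a.1 - a.2}

/-- `P₁Mon = {a ∈ S₂ : a₂ ≥ 1}`, the exponents of monomials in the facet prime
`P₁ = ⟨st, st²⟩` of `R_{A₂}`. -/
def P1Mon : Set (ℤ × ℤ) := {a | a ∈ Sset 2 ∧ 1 ≤ a.2}

/-- A polynomial vanishing at `(n, q n)` for all large integers `n` is divisible by the equation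
of the graph of `q`. -/
lemma X_sub_aeval_dvd_of_eval_eq_zero (q : Polynomial ℂ) (f : Cθ) (N : ℤ)
    (h : ∀ n : ℤ, N ≤ n → eval ![(n : ℂ), q.eval (n : ℂ)] f = 0) :
    X 1 - Polynomial.aeval (X 0 : Cθ) q ∣ f := by
  let restrict : Cθ →ₐ[ℂ] Polynomial ℂ := aeval ![Polynomial.X, q]
  have restrict_eval (z : ℂ) : (restrict f).eval z = eval ![z, q.eval z] f := by
    have key : (Polynomial.aeval z).comp restrict = aeval ![z, q.eval z] := by
      ext i
      fin_cases i <;> simp [restrict]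
    have := DFunLike.congr_fun key f
    simpa [MvPolynomial.aeval_eq_eval] using this
  have restrict_zero : restrict f = 0 := by
    refine Polynomial.eq_zero_of_infinite_isRoot _ (Set.Infinite.mono ?_
      ((Set.Ici_infinite N).image (Int.cast_injective (α := ℂ)).injOn))
    rintro _ ⟨n, hn, rfl⟩
    exact (restrict_eval _).trans (h n hn)
  let I : Ideal Cθ := Ideal.span {X 1 - Polynomial.aeval (X 0 : Cθ) q}
  have key : ((Ideal.Quotient.mkₐ ℂ I).comp (Polynomial.aeval (X 0 : Cθ))).comp restrict =
      Ideal.Quotient.mkₐ ℂ I := by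
    ext i
    fin_cases i
    · simp [restrict]
    · have : Ideal.Quotient.mk I (X 1) = Ideal.Quotient.mk I (Polynomial.aeval (X 0 : Cθ) q) :=
        Ideal.Quotient.eq.2 (Ideal.mem_span_singleton_self _)
      simp [restrict, this]
  have hf := DFunLike.congr_fun key f
  simp only [AlgHom.comp_apply, restrict_zero, map_zero] at hf
  exact Ideal.mem_span_singleton.1 (Ideal.Quotient.eq_zero_iff_mem.1 hf.symm)

lemma dfact_dvd {P f : Cθ} {m : ℤ} (h : ∀ j : ℕ, (j : ℤ) ≤ m → P - C (j : ℂ) ∣ f) :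
    dfact P m ∣ f := by
  refine Finset.prod_dvd_of_coprime ?_ fun j hj => h j ?_
  · intro i _ j _ hij
    have hne : (j : ℂ) - i ≠ 0 := sub_ne_zero.2 (by exact_mod_cast hij.symm)
    refine ⟨C ((j - i : ℂ)⁻¹), -C ((j - i : ℂ)⁻¹), ?_⟩
    have : (C ((j - i : ℂ)⁻¹) : Cθ) * (C (j : ℂ) - C (i : ℂ)) = 1 := by
      rw [← C_sub, ← C_mul, inv_mul_cancel₀ hne, C_1]
    linear_combination this
  · have := Finset.mem_range.1 hj
    omega

lemma eval_dfact_eq_zero_iff {P : Cθ} {v : Fin 2 → ℂ} {h : ℤ} (hP : eval v P = h) (m : ℤ) :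
    eval v (dfact P m) = 0 ↔ 0 ≤ h ∧ h ≤ m := by
  simp only [dfact, map_prod, map_sub, eval_C, hP, Finset.prod_eq_zero_iff, Finset.mem_range,
    sub_eq_zero]
  constructor
  · rintro ⟨j, hj, hhj⟩
    have : h = j := by exact_mod_cast hhj
    omega
  · rintro ⟨h0, hm⟩
    lift h to ℕ using h0
    exact ⟨h, by omega, by simp⟩

lemma mem_Omega_union_iff (d a : ℤ × ℤ) :
    a ∈ Omega 2 d ∪ {a | a ∈ P1Mon ∧ a + d ∉ P1Mon} ↔
      (0 ≤ a.2 ∧ a.2 ≤ 2 * a.1) ∧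
        ((d.2 < 0 ∧ a.2 ≤ -d.2) ∨ 2 * a.1 - a.2 ≤ -(2 * d.1) + d.2 - 1) := by
  simp only [Omega, P1Mon, Sset, Set.mem_union, Set.mem_ofPred_eq, Prod.fst_add, Prod.snd_add]
  omega

/-- All graded pieces of the idealizer `II(P₁)` for `R_{A₂} = ℂ[s, st, st²]`: the vanishing
ideal of `Ω(d) ∪ {a ∈ P₁Mon : a + d ∉ P₁Mon}` is principal, generated by
`E₁ · (H₂, −2d₁+d₂−1)!` with `E₁ = (H₁, −d₂)!` when `d₂ < 0` and `E₁ = 1` otherwise. -/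
theorem statement8 (d : ℤ × ℤ) :
    vanishingIdeal (Omega 2 d ∪ {a | a ∈ P1Mon ∧ a + d ∉ P1Mon}) =
      Ideal.span
        {(if d.2 < 0 then dfact (X 1) (-d.2) else 1) *
          dfact (C (2 : ℂ) * X 0 - X 1) (-(2 * d.1) + d.2 - 1)} := by
  set E : Cθ := if d.2 < 0 then dfact (X 1) (-d.2) else 1 with hE
  have eval_E (a : ℤ × ℤ) : eval ![(a.1 : ℂ), (a.2 : ℂ)] E = 0 ↔
      d.2 < 0 ∧ 0 ≤ a.2 ∧ a.2 ≤ -d.2 := by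
    by_cases hd : d.2 < 0
    · simp only [hE, hd, true_and]
      exact eval_dfact_eq_zero_iff (by simp) _
    · simp [hE, hd]
  ext f
  rw [Ideal.mem_span_singleton]
  constructor
  · intro hf
    replace hf (a : ℤ × ℤ) ha : eval ![(a.1 : ℂ), (a.2 : ℂ)] f = 0 :=
      hf a ((mem_Omega_union_iff d a).2 ha)
    have E_dvd : E ∣ f := by
      by_cases hd : d.2 < 0
      · rw [hE, if_pos hd]
        refine dfact_dvd fun j hj => ?_
        have := X_sub_aeval_dvd_of_eval_eq_zero (Polynomial.C (j : ℂ)) f j fun n hn => by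
          simpa using hf (n, j) ⟨by dsimp only; omega, Or.inl ⟨hd, hj⟩⟩
        simpa using this
      · simp [hE, hd]
    obtain ⟨g, rfl⟩ := E_dvd
    refine mul_dvd_mul_left E (dfact_dvd fun k hk => ?_)
    have := X_sub_aeval_dvd_of_eval_eq_zero
        (Polynomial.C 2 * Polynomial.X - Polynomial.C (k : ℂ)) g (|d.2| + k + 1) fun n hn => by
      have habs := neg_le_abs d.2
      have hpos := abs_nonneg d.2
      have hmul := hf (n, 2 * n - k) (by dsimp only; omega)
      rw [map_mul] at hmul
      have hne := (eval_E (n, 2 * n - k)).not.2 (by dsimp only; omega)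
      simpa using (mul_eq_zero.1 hmul).resolve_left hne
    rw [← neg_dvd]
    convert this using 1
    simp only [map_sub, map_mul, Polynomial.aeval_C, Polynomial.aeval_X, algebraMap_eq]
    ring
  · rintro ⟨g, rfl⟩ a ha
    obtain ⟨h0, h⟩ := (mem_Omega_union_iff d a).1 ha
    rw [map_mul, map_mul]
    rcases h with h | h
    · rw [(eval_E a).2 ⟨h.1, h0.1, h.2⟩, zero_mul, zero_mul]
    · rw [(eval_dfact_eq_zero_iff (h := 2 * a.1 - a.2) (by simp) _).2 ⟨by omega, h⟩, mul_zero,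
        zero_mul]

end
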